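/- (Activating a u-fan.) Let χ be a proper partial edge coloring of a finite simple graph G and let f = (u, v, w, α, β, β) be a u-fan with center u and leaves v and w; that is, u, v, w are distinct vertices, (u, v) and (u, w) are uncolored edges of G, α ∈ miss_χ(u), β ∈ miss_χ(v), β ∈ miss_χ(w), and α ≠ β. Then there exist an edge e ∈ {(u, v), (u, w)} and a proper partial edge coloring χ′ of G whose set of uncolored edges equals the set of uncolored edges of χ with the edge e removed. -/

import Mathlib

open Classical

/-- A partial edge coloring `χ` of a graph `G` is *proper* if no two distinct edges of `G`
sharing a vertex receive the same color. -/
def Proper {V C : Type*} (G : SimpleGraph V) (χ : Sym2 V → Option C) : Prop :=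
  ∀ e₁ ∈ G.edgeSet, ∀ e₂ ∈ G.edgeSet, e₁ ≠ e₂ →
    (∃ x : V, x ∈ e₁ ∧ x ∈ e₂) → ∀ c : C, χ e₁ = some c → χ e₂ ≠ some c

/-- The set of uncolored edges of `G` under the partial coloring `χ`. -/
def uncolored {V C : Type*} (G : SimpleGraph V) (χ : Sym2 V → Option C) : Set (Sym2 V) :=
  {e | e ∈ G.edgeSet ∧ χ e = none}

/-- `missing G χ u` is the set of colors not assigned by `χ` to any edge of `G` incident on `u`. -/
def missing {V C : Type*} (G : SimpleGraph V) (χ : Sym2 V → Option C) (u : V) : Set C :=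
  {c | ∀ e ∈ G.edgeSet, u ∈ e → χ e ≠ some c}

/-- The subgraph of `G` formed by the edges colored `α` or `β`. -/
def kempeGraph {V C : Type*} (G : SimpleGraph V) (χ : Sym2 V → Option C) (α β : C) :
    SimpleGraph V where
  Adj x y := G.Adj x y ∧ (χ s(x, y) = some α ∨ χ s(x, y) = some β)
  symm := ⟨fun x y h => by rw [Sym2.eq_swap]; exact ⟨h.1.symm, h.2⟩⟩
  loopless := ⟨fun x h => G.loopless.irrefl x h.1⟩

/-- The coloring obtained from `χ` by exchanging `α` and `β` on the Kempe component of `v`. -/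
noncomputable def kempeSwap {V C : Type*} (G : SimpleGraph V) (χ : Sym2 V → Option C)
    (α β : C) (v : V) : Sym2 V → Option C :=
  fun e => if ∃ x ∈ e, (kempeGraph G χ α β).Reachable v x
    then (χ e).map (Equiv.swap α β) else χ e

section

variable {V C : Type*} {G : SimpleGraph V} {χ : Sym2 V → Option C} {α β : C}

theorem kempeSwap_of_reachable {v x : V} {e : Sym2 V} (hx : x ∈ e)
    (hr : (kempeGraph G χ α β).Reachable v x) :
    kempeSwap G χ α β v e = (χ e).map (Equiv.swap α β) :=
  if_pos ⟨x, hx, hr⟩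

theorem kempeSwap_of_not_reachable {v x : V} {e : Sym2 V} (he : e ∈ G.edgeSet) (hx : x ∈ e)
    (hr : ¬ (kempeGraph G χ α β).Reachable v x) :
    kempeSwap G χ α β v e = χ e := by
  unfold kempeSwap
  split_ifs with h
  · obtain ⟨y, hy, hry⟩ := h
    have hxy : y ≠ x := by rintro rfl; exact hr hry
    obtain rfl : e = s(y, x) := (Sym2.mem_and_mem_iff hxy).1 ⟨hy, hx⟩
    have hc : ¬ (χ s(y, x) = some α ∨ χ s(y, x) = some β) := fun hc =>
      hr (hry.trans (SimpleGraph.Adj.reachable ⟨he, hc⟩))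
    rw [not_or] at hc
    cases hχ : χ s(y, x) with
    | none => rfl
    | some c =>
      rw [hχ] at hc
      simp only [Option.some.injEq] at hc
      simp [Equiv.swap_apply_of_ne_of_ne hc.1 hc.2]
  · rfl

theorem Proper.kempeSwap (h : Proper G χ) (v : V) : Proper G (kempeSwap G χ α β v) := by
  rintro e₁ h₁ e₂ h₂ hne ⟨x, hx₁, hx₂⟩ c hc₁ hc₂
  by_cases hr : (kempeGraph G χ α β).Reachable v x
  · rw [kempeSwap_of_reachable hx₁ hr, Option.map_eq_some_iff] at hc₁
    rw [kempeSwap_of_reachable hx₂ hr, Option.map_eq_some_iff] at hc₂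
    obtain ⟨a, ha, rfl⟩ := hc₁
    obtain ⟨b, hb, hab⟩ := hc₂
    obtain rfl := (Equiv.swap α β).injective hab
    exact h e₁ h₁ e₂ h₂ hne ⟨x, hx₁, hx₂⟩ b ha hb
  · rw [kempeSwap_of_not_reachable h₁ hx₁ hr] at hc₁
    rw [kempeSwap_of_not_reachable h₂ hx₂ hr] at hc₂
    exact h e₁ h₁ e₂ h₂ hne ⟨x, hx₁, hx₂⟩ c hc₁ hc₂

theorem uncolored_kempeSwap (v : V) : uncolored G (kempeSwap G χ α β v) = uncolored G χ := by
  ext e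
  unfold uncolored kempeSwap
  simp only [Set.mem_ofPred_eq]
  split_ifs <;> simp

theorem mem_missing_kempeSwap_self {v : V} (h : β ∈ missing G χ v) :
    α ∈ missing G (kempeSwap G χ α β v) v := by
  intro e he hv hc
  rw [kempeSwap_of_reachable hv (SimpleGraph.Reachable.refl v), Option.map_eq_some_iff] at hc
  obtain ⟨a, ha, hs⟩ := hc
  rw [Equiv.swap_apply_eq_iff, Equiv.swap_apply_left] at hs
  exact h e he hv (hs ▸ ha)

theorem mem_missing_kempeSwap_of_not_reachable {v u : V} {c : C}
    (hr : ¬ (kempeGraph G χ α β).Reachable v u) (h : c ∈ missing G χ u) :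
    c ∈ missing G (kempeSwap G χ α β v) u := by
  intro e he hu
  rw [kempeSwap_of_not_reachable he hu hr]
  exact h e he hu

theorem Proper.update (h : Proper G χ) {u v : V} {c : C}
    (hu : c ∈ missing G χ u) (hv : c ∈ missing G χ v) :
    Proper G (Function.update χ s(u, v) (some c)) := by
  have key : ∀ e ∈ G.edgeSet, (∃ x, x ∈ s(u, v) ∧ x ∈ e) → χ e ≠ some c := by
    rintro e he ⟨x, hx, hxe⟩
    rcases Sym2.mem_iff.1 hx with rfl | rfl
    exacts [hu e he hxe, hv e he hxe]
  rintro e₁ h₁ e₂ h₂ hne ⟨x, hx₁, hx₂⟩ d hd₁ hd₂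
  by_cases he₁ : e₁ = s(u, v)
  · subst he₁
    rw [Function.update_self] at hd₁
    rw [Function.update_of_ne hne.symm, ← hd₁] at hd₂
    exact key e₂ h₂ ⟨x, hx₁, hx₂⟩ hd₂
  · rw [Function.update_of_ne he₁] at hd₁
    by_cases he₂ : e₂ = s(u, v)
    · subst he₂
      rw [Function.update_self] at hd₂
      rw [← hd₂] at hd₁
      exact key e₁ h₁ ⟨x, hx₂, hx₁⟩ hd₁
    · rw [Function.update_of_ne he₂] at hd₂
      exact h e₁ h₁ e₂ h₂ hne ⟨x, hx₁, hx₂⟩ d hd₁ hd₂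

theorem uncolored_update (e : Sym2 V) (c : C) :
    uncolored G (Function.update χ e (some c)) = uncolored G χ \ {e} := by
  ext e'
  by_cases h : e' = e <;> simp [uncolored, h]

theorem exists_proper_of_not_reachable (h : Proper G χ) {u v : V}
    (hα : α ∈ missing G χ u) (hβ : β ∈ missing G χ v)
    (hr : ¬ (kempeGraph G χ α β).Reachable v u) :
    ∃ χ' : Sym2 V → Option C, Proper G χ' ∧ uncolored G χ' = uncolored G χ \ {s(u, v)} :=
  ⟨_, (h.kempeSwap v).update (mem_missing_kempeSwap_of_not_reachable hr hα)
      (mem_missing_kempeSwap_self hβ), by rw [uncolored_update, uncolored_kempeSwap]⟩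

/-- In an induced subgraph of the Kempe graph, the degree of a vertex is at most the number of
colors among `α` and `β` that it does not miss. -/
theorem Proper.degree_le_card (h : Proper G χ) {W : Type*} [Fintype W] {K : SimpleGraph W}
    (f : K ↪g kempeGraph G χ α β) (x : W) (S : Finset C)
    (hS : ∀ c ∈ ({α, β} : Finset C), c ∉ missing G χ (f x) → c ∈ S) : K.degree x ≤ S.card := by
  rw [← SimpleGraph.card_neighborFinset_eq_degree,
    ← Finset.card_map (⟨some, Option.some_injective C⟩ : C ↪ Option C)]
  refine Finset.card_le_card_of_injOn (fun y => χ s(f x, f y)) ?_ ?_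
  · intro y hy
    have hxy : (kempeGraph G χ α β).Adj (f x) (f y) := f.map_adj_iff.2 (by simpa using hy)
    have mem : ∀ c ∈ ({α, β} : Finset C), χ s(f x, f y) = some c →
        χ s(f x, f y) ∈ S.map ⟨some, Option.some_injective C⟩ := fun c hc hχ =>
      Finset.mem_map.2 ⟨c, hS c hc fun hm => hm _ hxy.1 (Sym2.mem_mk_left _ _) hχ, hχ.symm⟩
    rcases hxy.2 with hc | hc
    exacts [mem α (by simp) hc, mem β (by simp) hc]
  · intro y hy z hz hyz
    have hxy : (kempeGraph G χ α β).Adj (f x) (f y) := f.map_adj_iff.2 (by simpa using hy)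
    have hxz : (kempeGraph G χ α β).Adj (f x) (f z) := f.map_adj_iff.2 (by simpa using hz)
    by_contra hne
    have hne' : s(f x, f y) ≠ s(f x, f z) := fun he =>
      hne (f.injective (Sym2.congr_right.1 he))
    have hcol := h _ hxy.1 _ hxz.1 hne' ⟨f x, Sym2.mem_mk_left _ _, Sym2.mem_mk_left _ _⟩
    simp only at hyz
    rcases hxy.2 with hc | hc
    exacts [hcol α hc (hyz ▸ hc), hcol β hc (hyz ▸ hc)]

end

/-- A finite connected graph of maximum degree at most two has at most two vertices of degree
at most one. -/
theorem SimpleGraph.Connected.card_le_two_of_degree_le {W : Type*} [Fintype W]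
    {K : SimpleGraph W} (hK : K.Connected) (h₂ : ∀ x, K.degree x ≤ 2) (T : Finset W)
    (h₁ : ∀ x ∈ T, K.degree x ≤ 1) : T.card ≤ 2 := by
  have hE := hK.card_vert_le_card_edgeSet_add_one
  rw [Nat.card_eq_fintype_card, Nat.card_eq_fintype_card, ← SimpleGraph.edgeFinset_card] at hE
  have hsum : ∑ x, (K.degree x + if x ∈ T then 1 else 0) ≤ ∑ _x : W, 2 := by
    refine Finset.sum_le_sum fun x _ => ?_
    split_ifs with hx
    · exact Nat.succ_le_succ (h₁ x hx)
    · exact h₂ x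
  rw [Finset.sum_add_distrib, K.sum_degrees_eq_twice_card_edges] at hsum
  simp only [Finset.sum_boole, Finset.filter_univ_mem, Nat.cast_id, Finset.sum_const,
    Finset.card_univ, smul_eq_mul] at hsum
  omega

/-- **Activating a u-fan.** One of the two uncolored edges of the u-fan can be colored. -/
theorem activate_ufan
    {V C : Type*} [Fintype V]
    (G : SimpleGraph V) (χ : Sym2 V → Option C) (hproper : Proper G χ)
    (u v w : V) (huv : u ≠ v) (huw : u ≠ w) (hvw : v ≠ w)
    (α β : C) (hαβ : α ≠ β)
    (h_uv : s(u, v) ∈ uncolored G χ) (h_uw : s(u, w) ∈ uncolored G χ)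
    (hα : α ∈ missing G χ u) (hβv : β ∈ missing G χ v) (hβw : β ∈ missing G χ w) :
    ∃ e ∈ ({s(u, v), s(u, w)} : Set (Sym2 V)), ∃ χ' : Sym2 V → Option C,
      Proper G χ' ∧ uncolored G χ' = uncolored G χ \ {e} := by
  by_cases hv : (kempeGraph G χ α β).Reachable v u
  · by_cases hw : (kempeGraph G χ α β).Reachable w u
    · exfalso
      let D := (kempeGraph G χ α β).connectedComponentMk u
      let f : D.toSimpleGraph ↪g kempeGraph G χ α β := SimpleGraph.Embedding.induce _
      let u' : D := ⟨u, rfl⟩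
      let v' : D := ⟨v, SimpleGraph.ConnectedComponent.sound hv⟩
      let w' : D := ⟨w, SimpleGraph.ConnectedComponent.sound hw⟩
      have hcard : ({u', v', w'} : Finset D).card = 3 :=
        Finset.card_eq_three.2 ⟨u', v', w', fun h => huv (congrArg Subtype.val h),
          fun h => huw (congrArg Subtype.val h), fun h => hvw (congrArg Subtype.val h), rfl⟩
      have hle : ({u', v', w'} : Finset D).card ≤ 2 := by
        refine D.connected_toSimpleGraph.card_le_two_of_degree_le (fun x => ?_) _ fun x hx => ?_
        · exact (hproper.degree_le_card f x {α, β} fun c hc _ => hc).trans Finset.card_le_two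
        · simp only [Finset.mem_insert, Finset.mem_singleton] at hx
          rcases hx with rfl | rfl | rfl
          · refine hproper.degree_le_card f u' {β} fun c hc hm => ?_
            rcases Finset.mem_insert.1 hc with rfl | hc
            exacts [absurd hα hm, hc]
          · refine hproper.degree_le_card f v' {α} fun c hc hm => ?_
            rcases Finset.mem_insert.1 hc with rfl | hc
            exacts [Finset.mem_singleton_self _,
              absurd hβv (Finset.mem_singleton.1 hc ▸ hm)]
          · refine hproper.degree_le_card f w' {α} fun c hc hm => ?_
            rcases Finset.mem_insert.1 hc with rfl | hc
            exacts [Finset.mem_singleton_self _,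
              absurd hβw (Finset.mem_singleton.1 hc ▸ hm)]
      omega
    · exact ⟨s(u, w), by simp, exists_proper_of_not_reachable hproper hα hβw hw⟩
  · exact ⟨s(u, v), by simp, exists_proper_of_not_reachable hproper hα hβv hv⟩
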